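/- For every integer k ≥ 2, there exist infinitely many natural numbers m such that σ(m) is a perfect k-th power. -/

import Mathlib

theorem greedy_chars {ι G : Type*} [DecidableEq ι] [AddCommGroup G] [Fintype G] (k : ℕ) (hk : 2 ≤ k)
    (hG : ∀ g : G, k • g = 0) (g : ι → G) (s : Finset ι) :
    ∃ a : ι → ℂ, (∀ i, a i ≠ 0) ∧ ∃ T : Finset (AddChar G ℂ),
      (∀ ψ, (∀ i ∈ s, ψ (g i) ≠ a i) → ψ ∈ T) ∧
      T.card * k ^ s.card ≤ Fintype.card G * (k - 1) ^ s.card := by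
  classical
  induction s using Finset.induction_on with
  | empty =>
    refine ⟨fun _ => 1, by simp, Finset.univ, by simp, ?_⟩
    simp [AddChar.card_eq]
  | insert i s his ih =>
    obtain ⟨a, ha0, T, hT, hcard⟩ := ih
    have hk0 : k ≠ 0 := by omega
    have hmaps : ∀ ψ ∈ T, ψ (g i) ∈ Polynomial.nthRootsFinset k (1 : ℂ) := by
      intro ψ _
      rw [Polynomial.mem_nthRootsFinset (by omega), ← AddChar.map_nsmul_eq_pow, hG,
        AddChar.map_zero_eq_one]
    have hcardR : (Polynomial.nthRootsFinset k (1 : ℂ)).card = k :=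
      (Complex.isPrimitiveRoot_exp k hk0).card_nthRootsFinset
    obtain ⟨y, hy, hb⟩ := Finset.exists_le_card_fiber_of_nsmul_le_card_of_maps_to
      (s := T) (t := Polynomial.nthRootsFinset k (1 : ℂ)) (f := fun ψ => ψ (g i))
      (b := (T.card : ℚ) / k) hmaps (Finset.card_pos.1 (by omega)) (by
        rw [hcardR, nsmul_eq_mul]; field_simp; exact le_rfl)
    have hy0 : y ≠ 0 := by
      rintro rfl
      rw [Polynomial.mem_nthRootsFinset (by omega)] at hy
      simp [hk0] at hy
    refine ⟨Function.update a i y, ?_, T.filter (fun ψ => ¬ ψ (g i) = y), ?_, ?_⟩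
    · intro j
      by_cases h : j = i
      · subst h; simpa
      · simpa [h] using ha0 j
    · intro ψ hψ
      rw [Finset.mem_filter]
      refine ⟨hT ψ fun j hj => ?_, ?_⟩
      · have := hψ j (Finset.mem_insert_of_mem hj)
        rwa [Function.update_of_ne (by rintro rfl; exact his hj)] at this
      · simpa using hψ i (Finset.mem_insert_self _ _)
    · have h1 := Finset.card_filter_add_card_filter_not (s := T) (fun ψ => ψ (g i) = y)
      rw [div_le_iff₀ (by positivity)] at hb
      have hb' : T.card ≤ (T.filter (fun ψ => ψ (g i) = y)).card * k := by exact_mod_cast hb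
      rw [Finset.card_insert_of_notMem his, pow_succ, pow_succ]
      obtain ⟨m, rfl⟩ : ∃ m, k = m + 1 := ⟨k - 1, by omega⟩
      simp only [Nat.add_sub_cancel] at *
      have h2 : (T.filter (fun ψ => ¬ ψ (g i) = y)).card * (m + 1) ≤ T.card * m := by
        nlinarith
      calc _ = ((T.filter (fun ψ => ¬ ψ (g i) = y)).card * (m + 1)) * (m + 1) ^ s.card := by ring
        _ ≤ T.card * m * (m + 1) ^ s.card := by gcongr
        _ = (T.card * (m + 1) ^ s.card) * m := by ring
        _ ≤ (Fintype.card G * m ^ s.card) * m := by gcongr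
        _ = _ := by ring

theorem map_sum_addChar {ι G : Type*} [DecidableEq ι] [AddCommGroup G] (ψ : AddChar G ℂ)
    (g : ι → G) (t : Finset ι) : ψ (∑ i ∈ t, g i) = ∏ i ∈ t, ψ (g i) := by
  induction t using Finset.induction_on with
  | empty => simp
  | insert i s his ih =>
    rw [Finset.sum_insert his, Finset.prod_insert his, AddChar.map_add_eq_mul, ih]

theorem zero_sum {ι G : Type*} [DecidableEq ι] [AddCommGroup G] [Fintype G] (k : ℕ) (hk : 2 ≤ k)
    (hG : ∀ g : G, k • g = 0) (g : ι → G) (s : Finset ι)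
    (h : Fintype.card G * (k - 1) ^ s.card < k ^ s.card) :
    ∃ t ⊆ s, t.Nonempty ∧ ∑ i ∈ t, g i = 0 := by
  classical
  obtain ⟨a, ha0, T, hT, hcard⟩ := greedy_chars k hk hG g s
  have hT0 : T.card = 0 := by
    by_contra h0
    have : 1 * k ^ s.card ≤ T.card * k ^ s.card := Nat.mul_le_mul_right _ (by omega)
    omega
  rw [Finset.card_eq_zero] at hT0
  subst hT0
  by_contra! hno
  have hzero : ∑ ψ : AddChar G ℂ, ∏ i ∈ s, (a i - ψ (g i)) = 0 := by
    refine Finset.sum_eq_zero fun ψ _ => ?_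
    have := mt (hT ψ) (by simp)
    push Not at this
    obtain ⟨i, hi, hia⟩ := this
    exact Finset.prod_eq_zero hi (by rw [hia, sub_self])
  simp_rw [Finset.prod_sub] at hzero
  rw [Finset.sum_comm] at hzero
  rw [Finset.sum_eq_single ∅] at hzero
  · simp [Finset.prod_eq_zero_iff, ha0] at hzero
  · intro t ht hne
    rw [← Finset.mul_sum]
    have : ∀ ψ : AddChar G ℂ, ∏ i ∈ t, ψ (g i) = ψ (∑ i ∈ t, g i) := fun ψ =>
      (map_sum_addChar ψ g t).symm
    simp_rw [this]
    rw [AddChar.sum_apply_eq_ite, if_neg, mul_zero]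
    exact hno t (Finset.mem_powerset.1 ht) (Finset.nonempty_iff_ne_empty.2 hne)
  · simp

theorem kth_power_of_dvd (k n : ℕ) (hn : n ≠ 0) (h : ∀ q, k ∣ n.factorization q) :
    ∃ c, n = c ^ k := by
  choose e he using h
  refine ⟨∏ q ∈ n.primeFactors, q ^ e q, ?_⟩
  rw [← Finset.prod_pow]
  conv_lhs => rw [← Nat.prod_factorization_pow_eq_self hn]
  rw [Finsupp.prod, Nat.support_factorization]
  refine Finset.prod_congr rfl fun q _ => ?_
  rw [he q, ← pow_mul, mul_comm]

theorem sigma_prod_primes (t : Finset ℕ) (ht : ∀ p ∈ t, p.Prime) :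
    ArithmeticFunction.sigma 1 (∏ p ∈ t, p) = ∏ p ∈ t, (p + 1) := by
  rw [ArithmeticFunction.IsMultiplicative.map_prod (fun p => p)
    ArithmeticFunction.isMultiplicative_sigma t]
  · refine Finset.prod_congr rfl fun p hp => ?_
    rw [ArithmeticFunction.sigma_one_apply, Nat.Prime.sum_divisors (ht p hp)]
    
  · intro p hp q hq hpq
    exact (Nat.coprime_primes (ht p hp) (ht q hq)).2 hpq

theorem exists_subset (k : ℕ) (hk : 2 ≤ k) (P S : Finset ℕ) (hP : ∀ p ∈ P, p.Prime)
    (hS : ∀ p ∈ P, (p + 1).primeFactors ⊆ S)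
    (h : k ^ S.card * (k - 1) ^ P.card < k ^ P.card) :
    ∃ t ⊆ P, t.Nonempty ∧ ∃ c, ArithmeticFunction.sigma 1 (∏ p ∈ t, p) = c ^ k := by
  have : NeZero k := ⟨by omega⟩
  obtain ⟨t, htP, hne, hsum⟩ := zero_sum (G := S → ZMod k) k hk (by intro g; ext i; simp)
    (fun p => fun q => ((p + 1).factorization q : ZMod k)) P (by simpa using h)
  refine ⟨t, htP, hne, ?_⟩
  rw [sigma_prod_primes t fun p hp => hP p (htP hp)]
  refine kth_power_of_dvd k _ (Finset.prod_ne_zero_iff.2 fun p _ => by omega) fun q => ?_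
  rw [Nat.factorization_prod fun p _ => by omega, Finsupp.finsetSum_apply]
  by_cases hq : q ∈ S
  · have := congrFun hsum ⟨q, hq⟩
    rw [← ZMod.natCast_eq_zero_iff]
    simpa using this
  · rw [Finset.sum_eq_zero]
    · exact dvd_zero _
    · intro p hp
      refine Finsupp.notMem_support_iff.1 fun h => hq (hS p (htP hp) ?_)
      simpa using h

theorem exists_L (k : ℕ) (hk : 2 ≤ k) : ∃ L : ℕ, ∀ r n : ℕ, 1 ≤ r → L * r ≤ n →
    k ^ r * (k - 1) ^ n < k ^ n := by
  have hk0 : (0 : ℝ) < k := by positivity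
  obtain ⟨L, hL⟩ := exists_pow_lt_of_lt_one (show (0 : ℝ) < 1 / k by positivity)
    (show ((k - 1 : ℕ) : ℝ) / k < 1 by
      rw [div_lt_one hk0]; exact_mod_cast (by omega))
  have hL' : k * (k - 1) ^ L < k ^ L := by
    rw [div_pow, div_lt_div_iff₀ (by positivity) hk0] at hL
    have : (k - 1) ^ L * k < 1 * k ^ L := by exact_mod_cast hL
    linarith
  refine ⟨L, fun r n hr hn => ?_⟩
  obtain ⟨d, rfl⟩ := Nat.exists_eq_add_of_le hn
  calc k ^ r * (k - 1) ^ (L * r + d) = (k * (k - 1) ^ L) ^ r * (k - 1) ^ d := by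
        rw [mul_pow, pow_add, pow_mul]; ring
    _ ≤ (k * (k - 1) ^ L) ^ r * k ^ d := by gcongr; omega
    _ < (k ^ L) ^ r * k ^ d := by
        gcongr
    _ = _ := by rw [pow_add, pow_mul]

theorem exists_M (C : ℝ) : ∃ M : ℕ, 1 ≤ M ∧ C * M.totient < M := by
  have h := not_summable_one_div_on_primes
  have h2 : ¬ ∃ c, ∀ u : Finset ℕ, ∑ x ∈ u, Set.indicator {p | p.Prime} (fun n : ℕ => (1 : ℝ) / n) x ≤ c := by
    rintro ⟨c, hc⟩
    exact h (summable_of_sum_le (fun n => Set.indicator_nonneg (fun _ _ => by positivity) _) hc)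
  push Not at h2
  obtain ⟨u, hu⟩ := h2 (Real.log (max C 1))
  set v := u.filter Nat.Prime with hv
  have hvp : ∀ p ∈ v, p.Prime := fun p hp => (Finset.mem_filter.1 hp).2
  have hM0 : 0 < ∏ p ∈ v, p := Finset.prod_pos fun p hp => (hvp p hp).pos
  refine ⟨∏ p ∈ v, p, hM0, ?_⟩
  have hq := Nat.totient_eq_mul_prod_factors (∏ p ∈ v, p)
  rw [Nat.primeFactors_prod hvp] at hq
  have hR : ((∏ p ∈ v, p).totient : ℝ) = ((∏ p ∈ v, p : ℕ) : ℝ) * ∏ p ∈ v, (1 - (p : ℝ)⁻¹) := by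
    have := congrArg (fun x : ℚ => (x : ℝ)) hq
    push_cast at this ⊢
    exact this
  rw [hR]
  have hMR : (0 : ℝ) < ((∏ p ∈ v, p : ℕ) : ℝ) := by exact_mod_cast hM0
  have hsum : ∑ x ∈ u, Set.indicator {p | p.Prime} (fun n : ℕ => (1 : ℝ) / n) x
      = ∑ p ∈ v, (p : ℝ)⁻¹ := by
    rw [hv, Finset.sum_filter]
    refine Finset.sum_congr rfl fun p _ => ?_
    simp [Set.indicator_apply]
  rw [hsum] at hu
  have hprod : ∏ p ∈ v, (1 - (p : ℝ)⁻¹) ≤ Real.exp (- ∑ p ∈ v, (p : ℝ)⁻¹) := by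
    rw [← Finset.sum_neg_distrib, Real.exp_sum]
    refine Finset.prod_le_prod (fun p hp => ?_) fun p hp => ?_
    · have : (p : ℝ)⁻¹ ≤ 1 := inv_le_one_of_one_le₀ (by exact_mod_cast (hvp p hp).one_le)
      linarith
    · have := Real.add_one_le_exp (-(p : ℝ)⁻¹)
      linarith
  have hlt : Real.exp (- ∑ p ∈ v, (p : ℝ)⁻¹) < (max C 1)⁻¹ := by
    rw [← Real.exp_log (show (0 : ℝ) < max C 1 by positivity), ← Real.exp_neg]
    simpa using hu
  have h0 : 0 ≤ ∏ p ∈ v, (1 - (p : ℝ)⁻¹) := by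
    refine Finset.prod_nonneg (fun p hp => ?_)
    have : (p : ℝ)⁻¹ ≤ 1 := inv_le_one_of_one_le₀ (by exact_mod_cast (hvp p hp).one_le)
    linarith
  have hfin : C * ∏ p ∈ v, (1 - (p : ℝ)⁻¹) < 1 := by
    calc C * ∏ p ∈ v, (1 - (p : ℝ)⁻¹) ≤ max C 1 * ∏ p ∈ v, (1 - (p : ℝ)⁻¹) := by
          gcongr; exact le_max_left _ _
      _ < max C 1 * (max C 1)⁻¹ := by
          gcongr; exact hprod.trans_lt hlt
      _ = 1 := mul_inv_cancel₀ (by positivity)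
  nlinarith

theorem abel_le (f c : ℕ → ℝ) (hf : Antitone f) (hf0 : ∀ n, 0 ≤ f n)
    (hc : ∀ n, 0 ≤ ∑ i ∈ Finset.range n, c i) (n : ℕ) :
    0 ≤ ∑ i ∈ Finset.range n, f i * c i := by
  have key : ∀ n, f n * ∑ i ∈ Finset.range n, c i ≤ ∑ i ∈ Finset.range n, f i * c i := by
    intro n
    induction n with
    | zero => simp
    | succ n ih =>
      calc f (n + 1) * ∑ i ∈ Finset.range (n + 1), c i
          ≤ f n * ∑ i ∈ Finset.range (n + 1), c i :=
            mul_le_mul_of_nonneg_right (hf (Nat.le_succ n)) (hc _)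
        _ = f n * ∑ i ∈ Finset.range n, c i + f n * c n := by
            rw [Finset.sum_range_succ, mul_add]
        _ ≤ _ := by rw [Finset.sum_range_succ]; linarith
  exact (mul_nonneg (hf0 n) (hc n)).trans (key n)

/-- the weight `log p` on the primes in the class `-1` -/
noncomputable def wt (M n : ℕ) : ℝ :=
  open Classical in if n.Prime ∧ (n : ZMod M) = -1 then Real.log n else 0

theorem wt_nonneg (M n : ℕ) : 0 ≤ wt M n := by
  unfold wt
  split_ifs
  · exact Real.log_natCast_nonneg n
  · exact le_rfl

open Classical in
theorem wt_sum_le (M L D : ℕ) (hM : 1 ≤ M)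
    (hA : ∀ X : ℕ, ((Finset.range (X + 1)).filter
      (fun p : ℕ => p.Prime ∧ (p : ZMod M) = -1)).card ≤ L * Nat.primeCounting (2 * X / M) + D) :
    ∃ E : ℝ, 0 ≤ E ∧ ∀ X : ℕ, ∑ n ∈ Finset.range (X + 1), wt M n ≤ (12 * L + 1) / M * X + E := by
  have hM0 : (0 : ℝ) < M := by positivity
  have hlin : Filter.Tendsto (fun X : ℕ => (2 * X / M : ℝ)) Filter.atTop Filter.atTop := by
    have : (fun X : ℕ => (2 * X / M : ℝ)) = fun X : ℕ => (2 / M : ℝ) * X := by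
      ext X; ring
    rw [this]
    exact (tendsto_natCast_atTop_atTop).const_mul_atTop (by positivity)
  have e1 := hlin.eventually (Chebyshev.eventually_primeCounting_le (ε := 1) one_pos)
  have e2 := hlin.eventually (Filter.eventually_ge_atTop 2)
  have e3 : ∀ᶠ X : ℕ in Filter.atTop, (D : ℝ) * Real.log X ≤ X / M := by
    have h := (Real.isLittleO_log_id_atTop.bound
      (show (0 : ℝ) < 1 / ((D + 1) * M) by positivity))
    have h' := tendsto_natCast_atTop_atTop (R := ℝ) |>.eventually h
    filter_upwards [h'] with X hX
    have hl := Real.log_natCast_nonneg X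
    simp only [id, Real.norm_eq_abs, abs_of_nonneg hl, Nat.abs_cast] at hX
    calc (D : ℝ) * Real.log X ≤ (D + 1) * Real.log X := by gcongr; linarith
      _ ≤ (D + 1) * (1 / ((D + 1) * M) * X) := by gcongr
      _ = X / M := by field_simp
  have e4 : ∀ᶠ X : ℕ in Filter.atTop, M ^ 2 ≤ X := Filter.eventually_ge_atTop _
  obtain ⟨X0, hX0⟩ := Filter.eventually_atTop.1 (e1.and (e2.and (e3.and e4)))
  refine ⟨∑ n ∈ Finset.range (X0 + 1), wt M n, Finset.sum_nonneg fun n _ => wt_nonneg M n,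
    fun X => ?_⟩
  have hE0 : 0 ≤ ∑ n ∈ Finset.range (X0 + 1), wt M n := Finset.sum_nonneg fun n _ => wt_nonneg M n
  rcases le_total X X0 with hX | hX
  · have h1 : ∑ n ∈ Finset.range (X + 1), wt M n ≤ ∑ n ∈ Finset.range (X0 + 1), wt M n :=
      Finset.sum_le_sum_of_subset_of_nonneg (Finset.range_mono (by omega))
        fun n _ _ => wt_nonneg M n
    have : (0 : ℝ) ≤ (12 * L + 1) / M * X := by positivity
    linarith
  obtain ⟨h1, h2, h3, h4⟩ := hX0 X hX
  have hX1 : 1 ≤ X := le_trans (Nat.one_le_pow _ _ hM) h4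
  have hXR : (1 : ℝ) ≤ X := by exact_mod_cast hX1
  have hlX : 0 ≤ Real.log X := Real.log_natCast_nonneg X
  set y : ℝ := 2 * X / M with hy
  have hly : 0 < Real.log y := Real.log_pos (by linarith)
  have hfl : ⌊y⌋₊ = 2 * X / M := by
    rw [hy]
    have := Nat.floor_div_eq_div (K := ℝ) (2 * X) M
    push_cast at this
    exact this
  have hlogs : Real.log X ≤ 2 * Real.log y := by
    have : 2 * Real.log y = Real.log (y ^ 2) := by rw [Real.log_pow]; norm_num
    rw [this]
    apply Real.log_le_log (by linarith)
    have h4' : (M : ℝ) ^ 2 ≤ X := by exact_mod_cast h4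
    rw [hy, div_pow, le_div_iff₀ (by positivity)]
    nlinarith
  have hlog4 : Real.log 4 ≤ 2 := by
    have h := Real.log_two_lt_d9
    have : Real.log 4 = 2 * Real.log 2 := by
      rw [show (4 : ℝ) = 2 ^ 2 by norm_num, Real.log_pow]; norm_num
    linarith
  have hpi : (Nat.primeCounting (2 * X / M) : ℝ) * Real.log X ≤ 12 * X / M := by
    rw [hfl] at h1
    calc (Nat.primeCounting (2 * X / M) : ℝ) * Real.log X
        ≤ ((Real.log 4 + 1) * y / Real.log y) * (2 * Real.log y) := by gcongr
      _ = (Real.log 4 + 1) * (2 * y) := by field_simp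
      _ ≤ 3 * (2 * y) := by gcongr; linarith
      _ = 12 * X / M := by rw [hy]; ring
  have hsum : ∑ n ∈ Finset.range (X + 1), wt M n ≤
      (((Finset.range (X + 1)).filter (fun p : ℕ => p.Prime ∧ (p : ZMod M) = -1)).card : ℝ)
        * Real.log X := by
    unfold wt
    rw [← Finset.sum_filter, ← nsmul_eq_mul]
    refine Finset.sum_le_card_nsmul _ _ _ fun p hp => ?_
    rw [Finset.mem_filter, Finset.mem_range] at hp
    apply Real.log_le_log
    · exact_mod_cast hp.2.1.pos
    · exact_mod_cast (by omega)
  have hAR : (((Finset.range (X + 1)).filter (fun p : ℕ => p.Prime ∧ (p : ZMod M) = -1)).card : ℝ)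
      ≤ L * Nat.primeCounting (2 * X / M) + D := by exact_mod_cast hA X
  calc _ ≤ _ := hsum
    _ ≤ (L * Nat.primeCounting (2 * X / M) + D : ℝ) * Real.log X := by gcongr
    _ = L * (Nat.primeCounting (2 * X / M) * Real.log X) + D * Real.log X := by ring
    _ ≤ L * (12 * X / M) + X / M := by gcongr
    _ = (12 * L + 1) / M * X := by ring
    _ ≤ _ := by linarith

theorem partial_le (M : ℕ) (K E s : ℝ) (hE : 0 ≤ E) (hK : 0 ≤ K) (hs : 1 < s)
    (h : ∀ X : ℕ, ∑ n ∈ Finset.range (X + 1), wt M n ≤ K * X + E) (Y : ℕ) :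
    ∑ n ∈ Finset.range Y, wt M n / (n : ℝ) ^ s ≤ K * ∑' n : ℕ, 1 / (n : ℝ) ^ s + E := by
  have hw0 : wt M 0 = 0 := by simp [wt]
  have h1 := abel_le (fun n : ℕ => 1 / ((n : ℝ) + 1) ^ s)
    (fun n => (K + if n = 0 then E else 0) - wt M (n + 1))
    (by
      intro m n hmn
      have : (m : ℝ) ≤ n := by exact_mod_cast hmn
      dsimp only
      gcongr)
    (fun n => by positivity)
    (by
      intro n
      rw [Finset.sum_sub_distrib, Finset.sum_add_distrib]
      have := h n
      rw [Finset.sum_range_succ', hw0, add_zero] at this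
      rcases n with _ | n
      · simp
      · rw [Finset.sum_ite_eq' (Finset.range (n + 1)) 0]
        simp only [Finset.sum_const, Finset.card_range, nsmul_eq_mul, Finset.mem_range,
          Nat.succ_pos, if_true]
        linarith) Y
  have hsm : Summable fun n : ℕ => 1 / (n : ℝ) ^ s := Real.summable_one_div_nat_rpow.2 hs
  have h2 : ∑ n ∈ Finset.range Y, wt M n / (n : ℝ) ^ s
      ≤ ∑ n ∈ Finset.range (Y + 1), wt M n / (n : ℝ) ^ s :=
    Finset.sum_le_sum_of_subset_of_nonneg (Finset.range_mono (by omega))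
        fun n _ _ => div_nonneg (wt_nonneg M n) (by positivity)
  have h3 : ∑ n ∈ Finset.range (Y + 1), 1 / (n : ℝ) ^ s ≤ ∑' n : ℕ, 1 / (n : ℝ) ^ s :=
    hsm.sum_le_tsum _ fun n _ => by positivity
  rw [Finset.sum_range_succ', hw0] at h2
  rw [Finset.sum_range_succ'] at h3
  have h4 : (0 : ℝ) ≤ 1 / ((0 : ℕ) : ℝ) ^ s := by positivity
  have h5 : ∑ i ∈ Finset.range Y, 1 / ((i : ℝ) + 1) ^ s * (if i = 0 then E else 0) ≤ E := by
    simp only [mul_ite, mul_zero]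
    rw [Finset.sum_ite_eq']
    split_ifs <;> simp [hE]
  simp only [mul_sub, mul_add, Finset.sum_sub_distrib, Finset.sum_add_distrib] at h1
  rw [← Finset.sum_mul] at h1
  push_cast at h2 h3
  have h6 : ∑ i ∈ Finset.range Y, 1 / ((i : ℝ) + 1) ^ s * wt M (i + 1)
      = ∑ i ∈ Finset.range Y, wt M (i + 1) / ((i : ℝ) + 1) ^ s :=
    Finset.sum_congr rfl fun i _ => by ring
  rw [h6] at h1
  have h7 : K * ∑ i ∈ Finset.range Y, 1 / ((i : ℝ) + 1) ^ s ≤ K * ∑' n : ℕ, 1 / (n : ℝ) ^ s :=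
    mul_le_mul_of_nonneg_left (by push_cast at h4; linarith) hK
  simp only [zero_div, add_zero] at h2
  linarith

open Classical in
theorem density_bound (M L D : ℕ) (hM : 1 ≤ M)
    (hA : ∀ X : ℕ, ((Finset.range (X + 1)).filter
      (fun p : ℕ => p.Prime ∧ (p : ZMod M) = -1)).card ≤ L * Nat.primeCounting (2 * X / M) + D) :
    (M : ℝ) ≤ (12 * L + 1) * M.totient := by
  have : NeZero M := ⟨by omega⟩
  obtain ⟨E, hE, hwt⟩ := wt_sum_le M L D hM hA
  set K : ℝ := (12 * L + 1) / M with hKdef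
  have hK : 0 ≤ K := by positivity
  have hu : IsUnit (-1 : ZMod M) := isUnit_one.neg
  obtain ⟨C, hC⟩ := ArithmeticFunction.vonMangoldt.LSeries_residueClass_lower_bound hu
  have hnp := ArithmeticFunction.vonMangoldt.summable_residueClass_non_primes_div (-1 : ZMod M)
  set g : ℕ → ℝ := fun n => (if n.Prime then 0 else
    ArithmeticFunction.vonMangoldt.residueClass (-1 : ZMod M) n) / n with hg
  have hg0 : ∀ n, 0 ≤ g n := by
    intro n
    have := ArithmeticFunction.vonMangoldt.residueClass_nonneg (-1 : ZMod M) n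
    simp only [hg]
    split_ifs <;> positivity
  have hpt : ∀ (s : ℝ), 1 < s → ∀ n : ℕ,
      ArithmeticFunction.vonMangoldt.residueClass (-1 : ZMod M) n / (n : ℝ) ^ s
        ≤ g n + wt M n / (n : ℝ) ^ s := by
    intro s hs n
    have hr := ArithmeticFunction.vonMangoldt.residueClass_nonneg (-1 : ZMod M) n
    rcases Nat.eq_zero_or_pos n with rfl | hn
    · simp [hg, wt]
    by_cases hp : n.Prime
    · have : ArithmeticFunction.vonMangoldt.residueClass (-1 : ZMod M) n = wt M n := by
        simp [Set.indicator_apply, wt, hp, ArithmeticFunction.vonMangoldt_apply_prime hp]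
      rw [this]
      linarith [hg0 n]
    · have hw : 0 ≤ wt M n / (n : ℝ) ^ s := div_nonneg (wt_nonneg M n) (by positivity)
      have : ArithmeticFunction.vonMangoldt.residueClass (-1 : ZMod M) n / (n : ℝ) ^ s ≤ g n := by
        simp only [hg, hp, if_false]
        refine div_le_div_of_nonneg_left hr (by exact_mod_cast hn) ?_
        conv_lhs => rw [← Real.rpow_one n]
        exact Real.rpow_le_rpow_of_exponent_le (by exact_mod_cast hn) hs.le
      linarith
  have hmain : ∀ s : ℝ, s ∈ Set.Ioc (1 : ℝ) 2 → (M.totient : ℝ)⁻¹ ≤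
      K * ((s - 1) * ∑' n : ℕ, 1 / (n : ℝ) ^ s) + (C + E + ∑' n, g n) * (s - 1) := by
    intro s hs
    have h1 := hC hs
    have h2 : ∑' n : ℕ, ArithmeticFunction.vonMangoldt.residueClass (-1 : ZMod M) n / (n : ℝ) ^ s
        ≤ ∑' n, g n + (K * ∑' n : ℕ, 1 / (n : ℝ) ^ s + E) := by
      refine Real.tsum_le_of_sum_range_le (fun n => div_nonneg
        (ArithmeticFunction.vonMangoldt.residueClass_nonneg (-1 : ZMod M) n) (by positivity)) ?_
      intro Y
      refine (Finset.sum_le_sum fun n _ => hpt s hs.1 n).trans ?_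
      rw [Finset.sum_add_distrib]
      exact add_le_add (hnp.sum_le_tsum _ fun n _ => hg0 n)
        (partial_le M K E s hE hK hs.1 hwt Y)
    have h3 := h1.trans h2
    have hs1 : 0 < s - 1 := by linarith [hs.1]
    have h4 : (M.totient : ℝ)⁻¹ / (s - 1) ≤ ∑' n, g n + (K * ∑' n : ℕ, 1 / (n : ℝ) ^ s + E) + C := by
      linarith
    rw [div_le_iff₀ hs1] at h4
    linarith
  have hlim : Filter.Tendsto (fun s : ℝ => K * ((s - 1) * ∑' n : ℕ, 1 / (n : ℝ) ^ s) +
      (C + E + ∑' n, g n) * (s - 1)) (nhdsWithin 1 (Set.Ioi 1))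
      (nhds (K * 1 + (C + E + ∑' n, g n) * (1 - 1))) := by
    refine (tendsto_sub_mul_tsum_nat_rpow.const_mul K).add (Filter.Tendsto.const_mul _ ?_)
    have : ContinuousAt (fun s : ℝ => s - 1) 1 := by fun_prop
    exact this.tendsto.mono_left nhdsWithin_le_nhds
  have hfin : (M.totient : ℝ)⁻¹ ≤ K := by
    have := ge_of_tendsto hlim (b := (M.totient : ℝ)⁻¹) (by
      filter_upwards [Ioc_mem_nhdsGT (show (1 : ℝ) < 2 by norm_num)] with s hs using hmain s hs)
    simpa using this
  have hphi : (0 : ℝ) < M.totient := by exact_mod_cast Nat.totient_pos.2 (by omega)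
  have hM0 : (0 : ℝ) < M := by positivity
  rw [hKdef, inv_eq_one_div, div_le_div_iff₀ hphi hM0] at hfin
  linarith

theorem sigma_kth_power_infinite (k : ℕ) (hk : 2 ≤ k) :
    {m : ℕ | ∃ c : ℕ, ArithmeticFunction.sigma 1 (m) = c ^ k}.Infinite := by
  classical
  intro hfin
  obtain ⟨N, hN⟩ := hfin.bddAbove
  obtain ⟨L, hL⟩ := exists_L k hk
  obtain ⟨M, hM, hMφ⟩ := exists_M (12 * L + 1)
  have hnot := mt (density_bound M L (L * M + (N + 1)) hM) (not_le.2 hMφ)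
  push Not at hnot
  obtain ⟨X, hX⟩ := hnot
  set A := (Finset.range (X + 1)).filter (fun p : ℕ => p.Prime ∧ (p : ZMod M) = -1) with hA
  set P := A.filter (fun p => N < p) with hP
  set S := Nat.primesLE (2 * X / M) ∪ M.primeFactors with hS
  have hAP : A.card ≤ P.card + (N + 1) := by
    have h1 : A ⊆ P ∪ Finset.range (N + 1) := by
      intro p hp
      rw [Finset.mem_union, hP, Finset.mem_filter, Finset.mem_range]
      by_cases h : N < p
      · exact Or.inl ⟨hp, h⟩
      · exact Or.inr (by omega)
    have h2 := (Finset.card_le_card h1).trans (Finset.card_union_le _ _)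
    rwa [Finset.card_range] at h2
  have hScard : S.card ≤ Nat.primeCounting (2 * X / M) + M := by
    refine (Finset.card_union_le _ _).trans (add_le_add ?_ ?_)
    · simp
    · have : M.primeFactors ⊆ Finset.Icc 1 M := fun p hp => Finset.mem_Icc.2
        ⟨(Nat.prime_of_mem_primeFactors hp).one_le, Nat.le_of_mem_primeFactors hp⟩
      simpa using Finset.card_le_card this
  have hPmem : ∀ p ∈ P, p ≤ X ∧ p.Prime ∧ (p : ZMod M) = -1 ∧ N < p := by
    intro p hp
    rw [hP, Finset.mem_filter, hA, Finset.mem_filter, Finset.mem_range] at hp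
    exact ⟨by omega, hp.1.2.1, hp.1.2.2, hp.2⟩
  have hsub : ∀ p ∈ P, (p + 1).primeFactors ⊆ S := by
    intro p hp q hq
    obtain ⟨hpX, hpp, hpM, -⟩ := hPmem p hp
    have hqp := Nat.prime_of_mem_primeFactors hq
    have hqd := Nat.dvd_of_mem_primeFactors hq
    have hMd : M ∣ p + 1 := by
      rw [← ZMod.natCast_eq_zero_iff]
      push_cast
      rw [hpM]
      simp
    obtain ⟨u, hu⟩ := hMd
    rw [hS, Finset.mem_union]
    rw [hu] at hqd
    rcases (Nat.Prime.dvd_mul hqp).1 hqd with h | h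
    · exact Or.inr (Nat.mem_primeFactors.2 ⟨hqp, h, by omega⟩)
    · left
      rw [Nat.mem_primesLE]
      refine ⟨?_, hqp⟩
      have hu0 : 0 < u := Nat.pos_of_ne_zero (by rintro rfl; simp at hu)
      refine (Nat.le_of_dvd hu0 h).trans ?_
      rw [Nat.le_div_iff_mul_le (by omega)]
      have := hpp.one_le
      rw [mul_comm]
      omega
  have hcount : k ^ S.card * (k - 1) ^ P.card < k ^ P.card := by
    refine lt_of_le_of_lt ?_ (hL (Nat.primeCounting (2 * X / M) + M) P.card (by omega) ?_)
    · gcongr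
      omega
    · rw [mul_add]
      omega
  obtain ⟨t, htP, ⟨p, hp⟩, hc⟩ := exists_subset k hk P S (fun p hp => (hPmem p hp).2.1) hsub hcount
  have hle := hN hc
  have hp' := hPmem p (htP hp)
  have : p ≤ ∏ p ∈ t, p := Nat.le_of_dvd
    (Finset.prod_pos fun q hq => (hPmem q (htP hq)).2.1.pos) (Finset.dvd_prod_of_mem _ hp)
  omega
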